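/- arXiv:2003.09381 — 2 statements merged into one kernel-verified Lean document; each statement's English description precedes it below -/
import Mathlib

section
/- For all indices i, j with i < b and i + j = n − 1 (i.e., (i,j) lies on the anti-diagonal of the top-right block of Q_P), the minor μ(i, j) of Q_P equals det Q₃. -/
open MvPolynomial Matrix

noncomputable section

/-- The scalar sequence `u`: first `n = m*b` values are `0,…,0,1`, then it follows the
linear recurrence with coefficients `c`. -/
def uSeq (m b : ℕ) (c : Fin (m*b) → ZMod 2) : ℕ → ZMod 2
  | s =>
    if s < m*b then (if s = m*b - 1 then 1 else 0)
    else ∑ j : Fin (m*b), c j * uSeq m b c (s - m*b + j)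
  termination_by s => s
  decreasing_by have := j.isLt; omega

/-- The symbolic sequence `w t`: first `n = m*b` values are the indeterminates `X (t, s)`,
then it follows the linear recurrence with coefficients `c`. -/
def wPoly (m b : ℕ) (c : Fin (m*b) → ZMod 2) (t : Fin (m-1)) :
    ℕ → MvPolynomial ((Fin (m-1)) × ℕ) (ZMod 2)
  | s =>
    if s < m*b then X (t, s)
    else ∑ j : Fin (m*b), C (c j) * wPoly m b c t (s - m*b + j)
  termination_by s => s
  decreasing_by have := j.isLt; omega

/-- The matrix `Q_P` of Equation (13). -/
def QP (m b : ℕ) (hm : 2 ≤ m) (hb : 1 ≤ b) (c : Fin (m*b) → ZMod 2) :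
    Matrix (Fin (m*b)) (Fin (m*b)) (MvPolynomial ((Fin (m-1)) × ℕ) (ZMod 2)) :=
  fun i j =>
    if (i : ℕ) < b then C (uSeq m b c ((i : ℕ) + (j : ℕ)))
    else wPoly m b c
      ⟨((i : ℕ) - b) / b, by
        have hi := i.isLt
        have h2 : 2 * b ≤ m * b := Nat.mul_le_mul hm (le_refl b)
        have h1 : b * (m - 1) = m * b - b := by
          cases m with
          | zero => simp
          | succ m' => simp [Nat.succ_mul, Nat.mul_comm]
        have : (i : ℕ) - b < b * (m - 1) := by omega
        exact Nat.div_lt_of_lt_mul this⟩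
      (((i : ℕ) - b) % b + (j : ℕ))

/-- The map from `Fin (n-1)` to `Fin n` skipping the index `i`. -/
def skipIdx {n : ℕ} (i : Fin n) (k : Fin (n - 1)) : Fin n :=
  if (k : ℕ) < (i : ℕ) then ⟨k, by have := k.isLt; have := i.isLt; omega⟩
  else ⟨(k : ℕ) + 1, by have := k.isLt; have := i.isLt; omega⟩

/-- The minor `μ(i,j)`: determinant of the matrix obtained by deleting row `i` and
column `j`. -/
def minorQ {n : ℕ} {R : Type*} [CommRing R] (A : Matrix (Fin n) (Fin n) R) (i j : Fin n) : R :=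
  (A.submatrix (skipIdx i) (skipIdx j)).det

/-- The bottom-left block `Q₃` of `Q_P`: rows `b,…,n-1` and columns `0,…,n-b-1`. -/
def Q3 (m b : ℕ) (hm : 2 ≤ m) (hb : 1 ≤ b) (c : Fin (m*b) → ZMod 2) :
    Matrix (Fin (m*b - b)) (Fin (m*b - b)) (MvPolynomial ((Fin (m-1)) × ℕ) (ZMod 2)) :=
  fun i j =>
    QP m b hm hb c
      ⟨b + (i : ℕ), by have := i.isLt; omega⟩
      ⟨(j : ℕ), by have := j.isLt; omega⟩

end

theorem det_submatrix_equiv_of_charTwo {ι κ R : Type*} [Fintype ι] [DecidableEq ι] [Fintype κ]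
    [DecidableEq κ] [CommRing R] [CharP R 2] (A : Matrix ι ι R) (e f : κ ≃ ι) :
    (A.submatrix e f).det = A.det := by
  have h : A.submatrix e f = (A.submatrix e e).submatrix id (f.trans e.symm) := by
    ext x y
    simp
  rw [h, Matrix.det_permute', Matrix.det_submatrix_equiv_self]
  rcases Int.units_eq_one_or (Equiv.Perm.sign (f.trans e.symm)) with hs | hs <;>
    simp [hs, CharTwo.neg_eq]

theorem uSeq_of_lt (m b : ℕ) (c : Fin (m*b) → ZMod 2) {s : ℕ} (hs : s < m*b - 1) :
    uSeq m b c s = 0 := by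
  rw [uSeq, if_pos (by omega), if_neg (by omega)]

theorem uSeq_last (m b : ℕ) (c : Fin (m*b) → ZMod 2) (hn : 0 < m*b) :
    uSeq m b c (m*b - 1) = 1 := by
  rw [uSeq, if_pos (by omega), if_pos rfl]

theorem QP_eq_zero (m b : ℕ) (hm : 2 ≤ m) (hb : 1 ≤ b) (c : Fin (m*b) → ZMod 2)
    (i j : Fin (m*b)) (hi : (i : ℕ) < b) (hij : (i : ℕ) + (j : ℕ) < m*b - 1) :
    QP m b hm hb c i j = 0 := by
  rw [QP, if_pos hi, uSeq_of_lt m b c hij, map_zero]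

theorem QP_eq_one (m b : ℕ) (hm : 2 ≤ m) (hb : 1 ≤ b) (c : Fin (m*b) → ZMod 2)
    (i j : Fin (m*b)) (hi : (i : ℕ) < b) (hij : (i : ℕ) + (j : ℕ) = m*b - 1) :
    QP m b hm hb c i j = 1 := by
  rw [QP, if_pos hi, hij, uSeq_last m b c (by omega), map_one]

theorem skipIdx_val {n : ℕ} (i : Fin n) (k : Fin (n - 1)) :
    (skipIdx i k : ℕ) = if (k : ℕ) < i then (k : ℕ) else k + 1 := by
  unfold skipIdx
  split_ifs <;> rfl

/-- For `i < b` with `i + j = n - 1` (anti-diagonal of the top-right block),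
the minor `μ(i,j)` of `Q_P` equals `det Q₃`. -/
theorem minor_antidiagonal_eq_det_Q3
    (m b : ℕ) (hm : 2 ≤ m) (hb : 1 ≤ b) (c : Fin (m*b) → ZMod 2)
    (i j : Fin (m*b)) (hi : (i : ℕ) < b) (hij : (i : ℕ) + (j : ℕ) = m*b - 1) :
    minorQ (QP m b hm hb c) i j = (Q3 m b hm hb c).det := by
  have hbn : 2 * b ≤ m * b := Nat.mul_le_mul hm le_rfl
  -- Rows are split as top/bottom; columns as (reversed) right/left.
  let e : Fin (b - 1) ⊕ Fin (m*b - b) ≃ Fin (m*b - 1) :=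
    finSumFinEquiv.trans (finCongr (by omega))
  let f : Fin (b - 1) ⊕ Fin (m*b - b) ≃ Fin (m*b - 1) :=
    (((Equiv.sumComm _ _).trans ((Equiv.refl _).sumCongr Fin.revPerm)).trans
      finSumFinEquiv).trans (finCongr (by omega))
  have he₁ (k : Fin (b - 1)) : (e (Sum.inl k) : ℕ) = k := by simp [e]
  have he₂ (k : Fin (m*b - b)) : (e (Sum.inr k) : ℕ) = b - 1 + k := by simp [e]
  have hf₁ (k : Fin (b - 1)) : (f (Sum.inl k) : ℕ) = m*b - b + (b - 1 - (k + 1)) := by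
    simp [f, Fin.val_rev]
  have hf₂ (k : Fin (m*b - b)) : (f (Sum.inr k) : ℕ) = k := by simp [f]
  rw [minorQ, ← det_submatrix_equiv_of_charTwo _ e f, ← Matrix.fromBlocks_toBlocks
    (((QP m b hm hb c).submatrix (skipIdx i) (skipIdx j)).submatrix e f)]
  have h₁₂ : (((QP m b hm hb c).submatrix (skipIdx i) (skipIdx j)).submatrix e f).toBlocks₁₂
      = 0 := by
    ext1 k l
    refine QP_eq_zero m b hm hb c (skipIdx i (e (Sum.inl k))) (skipIdx j (f (Sum.inr l)))
      ?_ ?_ <;> simp only [skipIdx_val, he₁, hf₂] <;> split_ifs <;> omega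
  have h₂₂ : (((QP m b hm hb c).submatrix (skipIdx i) (skipIdx j)).submatrix e f).toBlocks₂₂
      = Q3 m b hm hb c := by
    ext1 k l
    refine congrArg₂ (QP m b hm hb c) (Fin.ext ?_) (Fin.ext ?_) <;>
      simp only [skipIdx_val, he₂, hf₂] <;> split_ifs <;> omega
  have h₁₁ : (((QP m b hm hb c).submatrix (skipIdx i) (skipIdx j)).submatrix e f).toBlocks₁₁.det
      = 1 := by
    rw [Matrix.det_of_isLowerTriangular]
    · refine Finset.prod_eq_one fun k _ => ?_
      refine QP_eq_one m b hm hb c (skipIdx i (e (Sum.inl k))) (skipIdx j (f (Sum.inl k)))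
        ?_ ?_ <;> simp only [skipIdx_val, he₁, hf₁] <;> split_ifs <;> omega
    · intro k l hkl
      have hkl' : (k : ℕ) < l := hkl
      refine QP_eq_zero m b hm hb c (skipIdx i (e (Sum.inl k))) (skipIdx j (f (Sum.inl l)))
        ?_ ?_ <;> simp only [skipIdx_val, he₁, hf₁] <;> split_ifs <;> omega
  rw [h₁₂, Matrix.det_fromBlocks_zero₁₂, h₁₁, h₂₂, one_mul]
end

section
/- For all indices i, j with b ≤ i < n and j < n − b (i.e., (i,j) lies in the bottom-left block Q₃ of Q_P), the minor μ(i, j) of Q_P is a polynomial of total degree exactly n − b − 1. -/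
open MvPolynomial Matrix

theorem skipIdx_eq_succAbove {n : ℕ} (i : Fin (n + 1)) (k : Fin n) :
    skipIdx i k = i.succAbove k := by
  ext
  simp only [skipIdx, Fin.succAbove, Fin.lt_def, Fin.val_castSucc]
  split_ifs <;> rfl

theorem adjugate_eq_neg_one_pow_mul_minorQ {n : ℕ} {R : Type*} [CommRing R]
    (A : Matrix (Fin n) (Fin n) R) (i j : Fin n) :
    A.adjugate j i = (-1) ^ (i + j : ℕ) * minorQ A i j := by
  cases n with
  | zero => exact i.elim0
  | succ n =>
    rw [adjugate_fin_succ_eq_det_submatrix, minorQ, funext (skipIdx_eq_succAbove i),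
      funext (skipIdx_eq_succAbove j)]

/-- A minor over a field is nonzero as soon as the only vector vanishing at `j` and orthogonal to
every row other than `i` is the zero vector. -/
theorem minorQ_ne_zero_of_forall_mulVec {n : ℕ} {K : Type*} [Field K]
    (A : Matrix (Fin n) (Fin n) K) (i j : Fin n)
    (h : ∀ x : Fin n → K, x j = 0 → (∀ k, k ≠ i → ∑ l, A k l * x l = 0) → x = 0) :
    minorQ A i j ≠ 0 := by
  intro h0
  have hadj : A.adjugate j i = 0 := by rw [adjugate_eq_neg_one_pow_mul_minorQ, h0, mul_zero]
  rw [adjugate_apply] at hadj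
  obtain ⟨x, hx, hAx⟩ := exists_mulVec_eq_zero_iff.mpr hadj
  refine hx (h x ?_ fun k hk => ?_)
  · simpa [mulVec, dotProduct, Pi.single_apply] using congrFun hAx i
  · simpa [mulVec, dotProduct, updateRow_ne hk] using congrFun hAx k

theorem map_minorQ {n : ℕ} {R S : Type*} [CommRing R] [CommRing S] (f : R →+* S)
    (A : Matrix (Fin n) (Fin n) R) (i j : Fin n) :
    f (minorQ A i j) = minorQ (A.map f) i j := by
  rw [minorQ, RingHom.map_det]
  rfl

theorem isHomogeneous_det {ι σ R : Type*} [Fintype ι] [DecidableEq ι] [CommRing R]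
    (A : Matrix ι ι (MvPolynomial σ R)) (d : ι → ℕ) (hA : ∀ k l, (A k l).IsHomogeneous (d k)) :
    A.det.IsHomogeneous (∑ k, d k) := by
  rw [det_apply]
  refine IsHomogeneous.sum _ _ _ fun τ _ => ?_
  have hprod : (∏ k, A (τ k) k).IsHomogeneous (∑ k, d k) := by
    rw [← Equiv.sum_comp τ d]
    exact IsHomogeneous.prod _ _ _ fun k _ => hA _ _
  rcases Int.units_eq_one_or (Equiv.Perm.sign τ) with h | h
  · simpa [h] using hprod
  · simpa [h] using hprod.neg

theorem wPoly_isHomogeneous (m b : ℕ) (c : Fin (m*b) → ZMod 2) (t : Fin (m-1)) (s : ℕ) :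
    (wPoly m b c t s).IsHomogeneous 1 := by
  induction s using Nat.strong_induction_on with
  | _ s ih =>
    rw [wPoly]
    split_ifs with h
    · exact isHomogeneous_X _ _
    · refine IsHomogeneous.sum _ _ _ fun j _ => (ih _ ?_).C_mul _
      have := j.isLt
      omega

theorem QP_isHomogeneous (m b : ℕ) (hm : 2 ≤ m) (hb : 1 ≤ b) (c : Fin (m*b) → ZMod 2)
    (k l : Fin (m*b)) :
    (QP m b hm hb c k l).IsHomogeneous (if (k : ℕ) < b then 0 else 1) := by
  rw [QP]
  split_ifs
  · exact isHomogeneous_C _ _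
  · exact wPoly_isHomogeneous _ _ _ _ _

theorem sum_skipIdx_degree {n b : ℕ} (i : Fin n) (hi : b ≤ (i : ℕ)) :
    ∑ k : Fin (n - 1), (if (skipIdx i k : ℕ) < b then 0 else 1) = n - b - 1 := by
  have hlt : ∀ k : Fin (n - 1), (skipIdx i k : ℕ) < b ↔ (k : ℕ) < b := by
    intro k
    unfold skipIdx
    split_ifs <;> grind
  simp only [hlt]
  rw [Fin.sum_univ_eq_sum_range (fun k => if k < b then 0 else 1) (n - 1)]
  have hsplit : n - 1 = b + (n - b - 1) := by
    have := i.isLt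
    omega
  rw [hsplit, Finset.sum_range_add, Finset.sum_eq_zero]
  · simp
  · intro k hk
    simpa using hk

theorem minorQ_QP_isHomogeneous (m b : ℕ) (hm : 2 ≤ m) (hb : 1 ≤ b) (c : Fin (m*b) → ZMod 2)
    (i j : Fin (m*b)) (hi : b ≤ (i : ℕ)) :
    (minorQ (QP m b hm hb c) i j).IsHomogeneous (m*b - b - 1) := by
  rw [← sum_skipIdx_degree i hi]
  exact isHomogeneous_det _ _ fun k l => QP_isHomogeneous m b hm hb c _ _

/-- The first `b` shifts of `u` form a triangular system in the last `b` coordinates. -/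
theorem eq_zero_of_uSeq_orthogonal (m b : ℕ) (c : Fin (m*b) → ZMod 2) (x : Fin (m*b) → ZMod 2)
    (hx : ∀ k < b, ∑ l : Fin (m*b), uSeq m b c (k + l) * x l = 0) (l : Fin (m*b))
    (hl : m*b - b ≤ (l : ℕ)) : x l = 0 := by
  obtain ⟨k, hk⟩ : ∃ k, k = m*b - 1 - (l : ℕ) := ⟨_, rfl⟩
  induction k using Nat.strong_induction_on generalizing l with
  | _ k ih =>
    have hl' := l.isLt
    have hsum := hx k (by omega)
    rw [Finset.sum_eq_single l] at hsum
    · rwa [uSeq, if_pos (by omega), if_pos (by omega), one_mul] at hsum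
    · intro l' _ hne
      have hne' : (l' : ℕ) ≠ l := fun h => hne (Fin.ext h)
      have := l'.isLt
      rcases lt_or_gt_of_ne hne' with h | h
      · rw [uSeq, if_pos (by omega), if_neg (by omega), zero_mul]
      · rw [ih (m*b - 1 - l') (by omega) l' (by omega) rfl, mul_zero]
    · simp

/-- A Hankel symbol supported on the antidiagonal `N - 1` and on the antidiagonal which is the
reflection of that of the position `(p, q)`. -/
def twoAntidiagonals (N p q k : ℕ) : ZMod 2 :=
  (if k = N - 1 then 1 else 0) + (if p + q ≠ N - 1 ∧ k + p + q = 2 * (N - 1) then 1 else 0)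

/-- Steps of constant nonzero length inside an interval eventually leave it. -/
theorem eq_zero_of_step {R : Type*} [Zero R] (y : ℤ → R) (N p d : ℤ) (hd : d ≠ 0)
    (hout : ∀ z, z < 0 ∨ N ≤ z → y z = 0) (hp : y p = 0)
    (hstep : ∀ z, 0 ≤ z → z < N → z ≠ p → y z = y (z + d)) (z : ℤ) : y z = 0 := by
  have hiter : ∀ s : ℕ, y z = 0 ∨ y z = y (z + s * d) := by
    intro s
    induction s with
    | zero => simp
    | succ s ih =>
      rcases ih with h | h
      · exact Or.inl h
      · rw [h]
        by_cases hz : z + s * d < 0 ∨ N ≤ z + s * d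
        · exact Or.inl (hout _ hz)
        by_cases hzp : z + s * d = p
        · exact Or.inl (hzp ▸ hp)
        · refine Or.inr ?_
          rw [hstep _ (by omega) (by omega) hzp]
          congr 1
          push_cast
          ring
  by_cases hz : z < 0 ∨ N ≤ z
  · exact hout _ hz
  obtain ⟨hz0, hzN⟩ : 0 ≤ z ∧ z < N := by omega
  rcases hiter N.toNat with h | h
  · exact h
  · rw [h]
    refine hout _ ?_
    rw [Int.toNat_of_nonneg (by omega)]
    rcases lt_or_gt_of_ne hd with hd | hd
    · left; nlinarith
    · right; nlinarith

theorem eq_zero_of_twoAntidiagonals_orthogonal {n N p q : ℕ} (hp : p < N) (hq : q < N)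
    (x : Fin n → ZMod 2) (hlarge : ∀ l : Fin n, N ≤ (l : ℕ) → x l = 0)
    (hxq : ∀ l : Fin n, (l : ℕ) = q → x l = 0)
    (hx : ∀ k < N, k ≠ p → ∑ l : Fin n, twoAntidiagonals N p q (k + l) * x l = 0) :
    x = 0 := by
  set y : ℤ → ZMod 2 := fun z => ∑ l : Fin n, if (l : ℤ) = z then x l else 0 with hy
  have hyx : ∀ l : Fin n, y l = x l := by
    intro l
    simp [hy, Fin.val_inj]
  have hout : ∀ z, z < 0 ∨ (N : ℤ) ≤ z → y z = 0 := by
    intro z hz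
    refine Finset.sum_eq_zero fun l _ => ?_
    split_ifs with h
    · exact hlarge l (by omega)
    · rfl
  have hyq : y q = 0 := by
    refine Finset.sum_eq_zero fun l _ => ?_
    split_ifs with h
    · exact hxq l (by omega)
    · rfl
  have hrow : ∀ z : ℤ, 0 ≤ z → z < N → z ≠ N - 1 - p →
      y z + (if p + q ≠ N - 1 then y (z + (N - 1 - p - q)) else 0) = 0 := by
    intro z h0 hN hzp
    have h := hx (N - 1 - z.toNat) (by omega) (by omega)
    refine Eq.trans ?_ h
    simp only [twoAntidiagonals, add_mul, Finset.sum_add_distrib, hy]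
    refine congrArg₂ (· + ·) ?_ ?_
    · refine Finset.sum_congr rfl fun l _ => ?_
      split_ifs <;> first | omega | simp
    · split_ifs with hpq
      · refine Finset.sum_congr rfl fun l _ => ?_
        split_ifs <;> first | omega | simp
      · simp [hpq]
  have hzero : ∀ z, y z = 0 := by
    by_cases hpq : p + q = N - 1
    · intro z
      by_cases hz : z < 0 ∨ (N : ℤ) ≤ z
      · exact hout z hz
      by_cases hzp : z = N - 1 - p
      · rw [hzp, ← hyq]
        congr 1
        omega
      · simpa [hpq] using hrow z (by omega) (by omega) hzp
    · have hstep : ∀ z : ℤ, 0 ≤ z → z < N → z ≠ N - 1 - p → y z = y (z + (N - 1 - p - q)) := by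
        intro z h0 hN hzp
        have h := hrow z h0 hN hzp
        rw [if_pos hpq] at h
        exact CharTwo.add_eq_zero.mp h
      refine eq_zero_of_step y N (N - 1 - p) (N - 1 - p - q) (by omega) hout ?_ hstep
      rw [← hyq, hstep q (by omega) (by omega) (by omega)]
      congr 1
      ring
  funext l
  rw [← hyx, hzero, Pi.zero_apply]

theorem eval_QP_of_lt (m b : ℕ) (hm : 2 ≤ m) (hb : 1 ≤ b) (c : Fin (m*b) → ZMod 2)
    (g : ℕ → ZMod 2) (k l : Fin (m*b)) (hk : b ≤ (k : ℕ)) (hl : (l : ℕ) < m*b - b) :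
    eval (fun v : Fin (m-1) × ℕ => g (b * v.1 + v.2)) (QP m b hm hb c k l) = g (k - b + l) := by
  have hmod := Nat.mod_lt ((k : ℕ) - b) hb
  rw [QP, if_neg (by omega), wPoly, if_pos (by omega), eval_X]
  simp only
  rw [← add_assoc, Nat.div_add_mod]

theorem minorQ_QP_ne_zero (m b : ℕ) (hm : 2 ≤ m) (hb : 1 ≤ b) (c : Fin (m*b) → ZMod 2)
    (i j : Fin (m*b)) (hi : b ≤ (i : ℕ)) (hj : (j : ℕ) < m*b - b) :
    minorQ (QP m b hm hb c) i j ≠ 0 := by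
  intro h0
  set g := twoAntidiagonals (m*b - b) (i - b) j with hg
  have h := congrArg (eval fun v : Fin (m-1) × ℕ => g (b * v.1 + v.2)) h0
  rw [map_zero, map_minorQ] at h
  refine minorQ_ne_zero_of_forall_mulVec _ i j (fun x hxj hx => ?_) h
  have hlarge : ∀ l : Fin (m*b), m*b - b ≤ (l : ℕ) → x l = 0 := by
    refine eq_zero_of_uSeq_orthogonal m b c x fun k hk => ?_
    have hne : (⟨k, by omega⟩ : Fin (m*b)) ≠ i := fun hki => by
      have := congrArg Fin.val hki
      simp only at this
      omega
    simpa [QP, hk] using hx _ hne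
  refine eq_zero_of_twoAntidiagonals_orthogonal (N := m*b - b) (p := i - b) (q := j)
    (by omega) hj x hlarge (fun l hl => Fin.ext hl ▸ hxj) fun k hk hki => ?_
  have hne : (⟨k + b, by omega⟩ : Fin (m*b)) ≠ i := fun hki => by
    have := congrArg Fin.val hki
    simp only at this
    omega
  rw [← hx _ hne]
  refine Finset.sum_congr rfl fun l _ => ?_
  by_cases hl : (l : ℕ) < m*b - b
  · rw [map_apply, eval_QP_of_lt m b hm hb c g _ l (by simp) hl]
    simp [hg]
  · rw [hlarge l (by omega), mul_zero, mul_zero]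

/-- For `b ≤ i < n` and `j < n - b` (the bottom-left block `Q₃`),
the minor `μ(i,j)` of `Q_P` has total degree exactly `n - b - 1`. -/
theorem minor_Q3_block_totalDegree
    (m b : ℕ) (hm : 2 ≤ m) (hb : 1 ≤ b) (c : Fin (m*b) → ZMod 2)
    (i j : Fin (m*b)) (hi : b ≤ (i : ℕ)) (hj : (j : ℕ) < m*b - b) :
    (minorQ (QP m b hm hb c) i j).totalDegree = m*b - b - 1 := by
  exact (minorQ_QP_isHomogeneous m b hm hb c i j hi).totalDegree
    (minorQ_QP_ne_zero m b hm hb c i j hi hj)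
end
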